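/- arXiv:2504.02147 — 4 statements merged into one kernel-verified Lean document; each statement's English description precedes it below -/
import Mathlib

section
/- Exact multiplication of a constrained polynomial matrix zonotope with a constrained polynomial zonotope (Proposition: Exact Multiplication, equality). Let 𝒴 = CPMZ(C, G_Y, E_Y, A_Y, B_Y, R_Y) ⊆ Matrix (Fin nx) (Fin n) ℝ with γ generators, p factors, and constraint matrices of size nc × na, and let 𝒫 = CPZ(c, G_P, E_P, A_P, b_P, R_P) ⊆ (Fin n → ℝ) with h generators, q constraint generators, and the same p factors (i.e., after merging identifiers both sets depend on a common factor vector α : Fin p → ℝ). Then the exact product 𝒴 ⊗ 𝒫 equals the set of all x : Fin nx → ℝ for which there exists α : Fin p → ℝ with α k ∈ Set.Icc (-1) 1 for all k such that x = C.mulVec c + ∑ i : Fin γ, (∏ k, (α k)^(E_Y k i)) • (G_Y i).mulVec c + ∑ j : Fin h, (∏ k, (α k)^(E_P k j)) • C.mulVec (fun r => G_P r j) + ∑ i : Fin γ, ∑ j : Fin h, (∏ k, (α k)^(E_Y k i + E_P k j)) • (G_Y i).mulVec (fun r => G_P r j), and the stacked constraints hold: ∑ i : Fin γ, (∏ k, (α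 k)^(R_Y k i)) • vec(A_Y i) = vec(B_Y) and ∑ j : Fin q, (∏ k, (α k)^(R_P k j)) • (fun r => A_P r j) = b_P. In particular 𝒴 ⊗ 𝒫 is itself a constrained polynomial zonotope in ℝ^nx. -/
open Matrix BigOperators

/-- Vectorization of a matrix. -/
def vecM {a b : ℕ} (M : Matrix (Fin a) (Fin b) ℝ) : Fin a × Fin b → ℝ :=
  fun ij => M ij.1 ij.2

theorem sum_smul_vecM_eq_iff {ι : Type*} [Fintype ι] {a b : ℕ} (w : ι → ℝ)
    (A : ι → Matrix (Fin a) (Fin b) ℝ) (B : Matrix (Fin a) (Fin b) ℝ) :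
    ∑ i, w i • vecM (A i) = vecM B ↔ ∑ i, w i • A i = B := by
  simp only [funext_iff, ← Matrix.ext_iff, Prod.forall, Finset.sum_apply, Matrix.sum_apply,
    Pi.smul_apply, Matrix.smul_apply, vecM]

theorem add_sum_smul_mulVec_add_sum_smul {R ι κ m n : Type*} [CommRing R] [Fintype ι] [Fintype κ]
    [Fintype n] (C : Matrix m n R) (G : ι → Matrix m n R) (c : n → R) (g : κ → n → R)
    (u : ι → R) (v : κ → R) :
    (C + ∑ i, u i • G i) *ᵥ (c + ∑ j, v j • g j) =
      C *ᵥ c + ∑ i, u i • (G i *ᵥ c) + ∑ j, v j • (C *ᵥ g j)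
        + ∑ i, ∑ j, (u i * v j) • (G i *ᵥ g j) := by
  simp only [Matrix.add_mulVec, Matrix.mulVec_add, Matrix.sum_mulVec, Matrix.mulVec_sum,
    Matrix.smul_mulVec, Matrix.mulVec_smul, Finset.smul_sum, smul_smul, Finset.sum_add_distrib,
    smul_add]
  rw [Finset.sum_comm (s := (Finset.univ : Finset κ))]
  simp only [mul_comm (v _)]
  abel

/-- Exact multiplication of a constrained polynomial matrix zonotope with a
constrained polynomial zonotope (Proposition: Exact Multiplication, equality). -/
theorem cpmz_cpz_exact_mult {nx n γ p h nc na mP q : ℕ}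
    (C : Matrix (Fin nx) (Fin n) ℝ) (GY : Fin γ → Matrix (Fin nx) (Fin n) ℝ)
    (EY : Matrix (Fin p) (Fin γ) ℕ) (AY : Fin γ → Matrix (Fin nc) (Fin na) ℝ)
    (BY : Matrix (Fin nc) (Fin na) ℝ) (RY : Matrix (Fin p) (Fin γ) ℕ)
    (c : Fin n → ℝ) (GP : Matrix (Fin n) (Fin h) ℝ) (EP : Matrix (Fin p) (Fin h) ℕ)
    (AP : Matrix (Fin mP) (Fin q) ℝ) (bP : Fin mP → ℝ) (RP : Matrix (Fin p) (Fin q) ℕ) :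
    {x : Fin nx → ℝ | ∃ α : Fin p → ℝ,
        (∀ k, α k ∈ Set.Icc (-1 : ℝ) 1) ∧
        (∑ i, (∏ k, (α k) ^ (RY k i)) • AY i = BY) ∧
        (∑ j, (∏ k, (α k) ^ (RP k j)) • (fun r => AP r j) = bP) ∧
        x = (C + ∑ i, (∏ k, (α k) ^ (EY k i)) • GY i).mulVec
              (c + ∑ j, (∏ k, (α k) ^ (EP k j)) • (fun r => GP r j))} =
    {x : Fin nx → ℝ | ∃ α : Fin p → ℝ,
        (∀ k, α k ∈ Set.Icc (-1 : ℝ) 1) ∧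
        x = C.mulVec c + ∑ i, (∏ k, (α k) ^ (EY k i)) • (GY i).mulVec c
            + ∑ j, (∏ k, (α k) ^ (EP k j)) • C.mulVec (fun r => GP r j)
            + ∑ i, ∑ j, (∏ k, (α k) ^ (EY k i + EP k j)) •
                (GY i).mulVec (fun r => GP r j) ∧
        (∑ i, (∏ k, (α k) ^ (RY k i)) • vecM (AY i) = vecM BY) ∧
        (∑ j, (∏ k, (α k) ^ (RP k j)) • (fun r => AP r j) = bP)} := by
  ext x
  simp only [Set.mem_ofPred_eq, sum_smul_vecM_eq_iff, add_sum_smul_mulVec_add_sum_smul, pow_add,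
    Finset.prod_mul_distrib]
  exact exists_congr fun α => by tauto
end

section
/- Exact multiplication of a CPMZ with a CPZ, forward inclusion. With 𝒴 = CPMZ(C, G_Y, E_Y, A_Y, B_Y, R_Y) ⊆ Matrix (Fin nx) (Fin n) ℝ (γ generators, p factors, constraints of size nc × na) and 𝒫 = CPZ(c, G_P, E_P, A_P, b_P, R_P) ⊆ (Fin n → ℝ) (h generators, q constraint generators, same p factors), every element of the exact product 𝒴 ⊗ 𝒫 belongs to the set of all x : Fin nx → ℝ for which there exists α : Fin p → ℝ with α k ∈ Set.Icc (-1) 1 for all k such that x = C.mulVec c + ∑ i : Fin γ, (∏ k, (α k)^(E_Y k i)) • (G_Y i).mulVec c + ∑ j : Fin h, (∏ k, (α k)^(E_P k j)) • C.mulVec (fun r => G_P r j) + ∑ i : Fin γ, ∑ j : Fin h, (∏ k, (α k)^(E_Y k i + E_P k j)) • (G_Y i).mulVec (fun r => G_P r j), and both ∑ i, (∏ k, (α k)^(R_Y k i)) • vec(A_Y i) = vec(B_Y) and ∑ j, (∏ k, (α k)^(R_P k j)) • (fun r => A_P r j) = b_P hold. -/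
open Matrix BigOperators

/-- Exact multiplication of a CPMZ with a CPZ, forward inclusion. -/
theorem cpmz_cpz_exact_mult_subset {nx n γ p h nc na mP q : ℕ}
    (C : Matrix (Fin nx) (Fin n) ℝ) (GY : Fin γ → Matrix (Fin nx) (Fin n) ℝ)
    (EY : Matrix (Fin p) (Fin γ) ℕ) (AY : Fin γ → Matrix (Fin nc) (Fin na) ℝ)
    (BY : Matrix (Fin nc) (Fin na) ℝ) (RY : Matrix (Fin p) (Fin γ) ℕ)
    (c : Fin n → ℝ) (GP : Matrix (Fin n) (Fin h) ℝ) (EP : Matrix (Fin p) (Fin h) ℕ)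
    (AP : Matrix (Fin mP) (Fin q) ℝ) (bP : Fin mP → ℝ) (RP : Matrix (Fin p) (Fin q) ℕ) :
    {x : Fin nx → ℝ | ∃ α : Fin p → ℝ,
        (∀ k, α k ∈ Set.Icc (-1 : ℝ) 1) ∧
        (∑ i, (∏ k, (α k) ^ (RY k i)) • AY i = BY) ∧
        (∑ j, (∏ k, (α k) ^ (RP k j)) • (fun r => AP r j) = bP) ∧
        x = (C + ∑ i, (∏ k, (α k) ^ (EY k i)) • GY i).mulVec
              (c + ∑ j, (∏ k, (α k) ^ (EP k j)) • (fun r => GP r j))} ⊆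
    {x : Fin nx → ℝ | ∃ α : Fin p → ℝ,
        (∀ k, α k ∈ Set.Icc (-1 : ℝ) 1) ∧
        x = C.mulVec c + ∑ i, (∏ k, (α k) ^ (EY k i)) • (GY i).mulVec c
            + ∑ j, (∏ k, (α k) ^ (EP k j)) • C.mulVec (fun r => GP r j)
            + ∑ i, ∑ j, (∏ k, (α k) ^ (EY k i + EP k j)) •
                (GY i).mulVec (fun r => GP r j) ∧
        (∑ i, (∏ k, (α k) ^ (RY k i)) • vecM (AY i) = vecM BY) ∧
        (∑ j, (∏ k, (α k) ^ (RP k j)) • (fun r => AP r j) = bP)} := by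
  rintro x ⟨α, hα, hY, hP, rfl⟩
  refine ⟨α, hα, ?_, ?_, hP⟩
  · simp only [Matrix.add_mulVec, Matrix.mulVec_add, Matrix.sum_mulVec, Matrix.mulVec_sum,
      Matrix.smul_mulVec, Matrix.mulVec_smul, Finset.smul_sum, Finset.sum_add_distrib,
      smul_add, smul_smul, pow_add, Finset.prod_mul_distrib]
    rw [Finset.sum_comm (s := (Finset.univ : Finset (Fin h)))]
    simp only [mul_comm (∏ k, α k ^ EP k _)]
    abel
  · subst hY
    ext ij
    simp [vecM, Matrix.sum_apply]
end

section
/- Exact multiplication of a CPMZ with a CPZ, reverse inclusion. With 𝒴 = CPMZ(C, G_Y, E_Y, A_Y, B_Y, R_Y) ⊆ Matrix (Fin nx) (Fin n) ℝ (γ generators, p factors, constraints of size nc × na) and 𝒫 = CPZ(c, G_P, E_P, A_P, b_P, R_P) ⊆ (Fin n → ℝ) (h generators, q constraint generators, same p factors), consider the set 𝒫̂ of all x : Fin nx → ℝ for which there exists α : Fin p → ℝ with α k ∈ Set.Icc (-1) 1 for all k such that x = C.mulVec c + ∑ i : Fin γ, (∏ k, (α k)^(E_Y k i)) • (G_Y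 i).mulVec c + ∑ j : Fin h, (∏ k, (α k)^(E_P k j)) • C.mulVec (fun r => G_P r j) + ∑ i : Fin γ, ∑ j : Fin h, (∏ k, (α k)^(E_Y k i + E_P k j)) • (G_Y i).mulVec (fun r => G_P r j), and both ∑ i, (∏ k, (α k)^(R_Y k i)) • vec(A_Y i) = vec(B_Y) and ∑ j, (∏ k, (α k)^(R_P k j)) • (fun r => A_P r j) = b_P hold. Then every element of 𝒫̂ can be written as Y.mulVec p for some matrix Y ∈ 𝒴 and vector p ∈ 𝒫 realized by a common factor vector α, i.e., 𝒫̂ ⊆ 𝒴 ⊗ 𝒫. -/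
open Matrix BigOperators

/-- Exact multiplication of a CPMZ with a CPZ, reverse inclusion. -/
theorem cpmz_cpz_exact_mult_supset {nx n γ p h nc na mP q : ℕ}
    (C : Matrix (Fin nx) (Fin n) ℝ) (GY : Fin γ → Matrix (Fin nx) (Fin n) ℝ)
    (EY : Matrix (Fin p) (Fin γ) ℕ) (AY : Fin γ → Matrix (Fin nc) (Fin na) ℝ)
    (BY : Matrix (Fin nc) (Fin na) ℝ) (RY : Matrix (Fin p) (Fin γ) ℕ)
    (c : Fin n → ℝ) (GP : Matrix (Fin n) (Fin h) ℝ) (EP : Matrix (Fin p) (Fin h) ℕ)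
    (AP : Matrix (Fin mP) (Fin q) ℝ) (bP : Fin mP → ℝ) (RP : Matrix (Fin p) (Fin q) ℕ) :
    {x : Fin nx → ℝ | ∃ α : Fin p → ℝ,
        (∀ k, α k ∈ Set.Icc (-1 : ℝ) 1) ∧
        x = C.mulVec c + ∑ i, (∏ k, (α k) ^ (EY k i)) • (GY i).mulVec c
            + ∑ j, (∏ k, (α k) ^ (EP k j)) • C.mulVec (fun r => GP r j)
            + ∑ i, ∑ j, (∏ k, (α k) ^ (EY k i + EP k j)) •
                (GY i).mulVec (fun r => GP r j) ∧
        (∑ i, (∏ k, (α k) ^ (RY k i)) • vecM (AY i) = vecM BY) ∧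
        (∑ j, (∏ k, (α k) ^ (RP k j)) • (fun r => AP r j) = bP)} ⊆
    {x : Fin nx → ℝ | ∃ α : Fin p → ℝ,
        (∀ k, α k ∈ Set.Icc (-1 : ℝ) 1) ∧
        (∑ i, (∏ k, (α k) ^ (RY k i)) • AY i = BY) ∧
        (∑ j, (∏ k, (α k) ^ (RP k j)) • (fun r => AP r j) = bP) ∧
        x = (C + ∑ i, (∏ k, (α k) ^ (EY k i)) • GY i).mulVec
              (c + ∑ j, (∏ k, (α k) ^ (EP k j)) • (fun r => GP r j))} := by
  rintro x ⟨α, hα, rfl, hY, hP⟩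
  refine ⟨α, hα, ?_, hP, ?_⟩
  · ext a b
    simpa [vecM, Matrix.sum_apply] using congrFun hY (a, b)
  · simp only [Matrix.add_mulVec, Matrix.mulVec_add, Matrix.mulVec_sum, Matrix.sum_mulVec,
      Matrix.mulVec_smul, Matrix.smul_mulVec, pow_add, Finset.prod_mul_distrib, mul_smul,
      smul_add, Finset.smul_sum, Finset.sum_add_distrib]
    rw [Finset.sum_comm, add_assoc]
    congr 2
    exact Finset.sum_congr rfl fun j _ => Finset.sum_congr rfl fun i _ => smul_comm _ _ _
end

section
/- Over-approximation of the exact reachable set by the data-driven recursion. Let Φ_tr : Matrix (Fin nx) (Fin nx) ℝ, Γ_tr : Matrix (Fin nx) (Fin nu) ℝ, and let M_tr : Matrix (Fin nx) (Fin nx ⊕ Fin nu) ℝ be the block matrix with M_tr i (Sum.inl j) = Φ_tr i j and M_tr i (Sum.inr j) = Γ_tr i j. Let 𝓜 ⊆ Matrix (Fin nx) (Fin nx ⊕ Fin nu) ℝ with M_tr ∈ 𝓜, let 𝓧₀ ⊆ (Fin nx → ℝ), let 𝓤 : ℕ → Set (Fin nu → ℝ), and let 𝓩_w ⊆ (Fin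 nx → ℝ). Define R̂ : ℕ → Set (Fin nx → ℝ) by R̂ 0 = 𝓧₀ and R̂ (k+1) = {M.mulVec (Sum.elim x u) + w | M ∈ 𝓜, x ∈ R̂ k, u ∈ 𝓤 k, w ∈ 𝓩_w}. Define the exact reachable set R_N as the set of all x_N : Fin nx → ℝ for which there exist sequences x : ℕ → (Fin nx → ℝ), u : ℕ → (Fin nu → ℝ), w : ℕ → (Fin nx → ℝ) with x 0 ∈ 𝓧₀, u k ∈ 𝓤 k and w k ∈ 𝓩_w for all k < N, x (k+1) = Φ_tr.mulVec (x k) + Γ_tr.mulVec (u k) + w k for all k < N, and x_N = x N. Then R_N ⊆ R̂ N for every N ∈ ℕ. -/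
open Matrix BigOperators

/-- Over-approximation of the exact reachable set by the data-driven recursion. -/
theorem reachable_set_overapprox {nx nu : ℕ}
    (Φtr : Matrix (Fin nx) (Fin nx) ℝ) (Γtr : Matrix (Fin nx) (Fin nu) ℝ)
    (Mtr : Matrix (Fin nx) (Fin nx ⊕ Fin nu) ℝ)
    (hMl : ∀ i j, Mtr i (Sum.inl j) = Φtr i j)
    (hMr : ∀ i j, Mtr i (Sum.inr j) = Γtr i j)
    (𝓜 : Set (Matrix (Fin nx) (Fin nx ⊕ Fin nu) ℝ)) (hMtr : Mtr ∈ 𝓜)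
    (𝓧₀ : Set (Fin nx → ℝ)) (𝓤 : ℕ → Set (Fin nu → ℝ)) (𝓩w : Set (Fin nx → ℝ))
    (Rhat : ℕ → Set (Fin nx → ℝ))
    (h0 : Rhat 0 = 𝓧₀)
    (hstep : ∀ k, Rhat (k + 1) =
      {y : Fin nx → ℝ | ∃ M ∈ 𝓜, ∃ x ∈ Rhat k, ∃ u ∈ 𝓤 k, ∃ w ∈ 𝓩w,
        y = M.mulVec (Sum.elim x u) + w})
    (N : ℕ) :
    {xN : Fin nx → ℝ |
        ∃ (x : ℕ → (Fin nx → ℝ)) (u : ℕ → (Fin nu → ℝ)) (w : ℕ → (Fin nx → ℝ)),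
          x 0 ∈ 𝓧₀ ∧ (∀ k < N, u k ∈ 𝓤 k) ∧ (∀ k < N, w k ∈ 𝓩w) ∧
          (∀ k < N, x (k + 1) = Φtr.mulVec (x k) + Γtr.mulVec (u k) + w k) ∧
          xN = x N} ⊆ Rhat N := by
  rintro _ ⟨x, u, w, hx0, hu, hw, hx, rfl⟩
  have hM : Mtr = Matrix.fromCols Φtr Γtr := by
    ext i (j | j)
    · exact hMl i j
    · exact hMr i j
  have mem_Rhat : ∀ k ≤ N, x k ∈ Rhat k := by
    intro k
    induction k with
    | zero => exact fun _ => h0 ▸ hx0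
    | succ k ih =>
      intro hk
      rw [hstep]
      refine ⟨Mtr, hMtr, x k, ih (by omega), u k, hu k hk, w k, hw k hk, ?_⟩
      rw [hx k hk, hM, Matrix.fromCols_mulVec_sumElim]
  exact mem_Rhat N le_rfl
end
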